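/- Assume the structure hypotheses (H). Then every crossing copy of K_{s,t} in G is either of Type 1 or of Type 2. -/

import Mathlib

open scoped Classical
open Finset

namespace PaperTiling

variable {V : Type*} [Fintype V] [DecidableEq V]

/-- The number of neighbours of `v` inside the set `S`. -/
noncomputable def degS (G : SimpleGraph V) (v : V) (S : Finset V) : ℕ :=
  (S.filter fun w => G.Adj v w).card

/-- The number of edges of `G` with one end in `A` and the other in `B`. -/
noncomputable def eAB (G : SimpleGraph V) (A B : Finset V) : ℕ :=
  ∑ v ∈ A, degS G v B

/-- The edge density `d(A,B) = e(A,B)/(|A||B|)`. -/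
noncomputable def dens (G : SimpleGraph V) (A B : Finset V) : ℝ :=
  (eAB G A B : ℝ) / ((A.card : ℝ) * (B.card : ℝ))

/-- `G` is a bipartite graph with parts `A` and `B`. -/
def IsBipartition (G : SimpleGraph V) (A B : Finset V) : Prop :=
  Disjoint A B ∧ A ∪ B = Finset.univ ∧
    ∀ u v : V, G.Adj u v → (u ∈ A ∧ v ∈ B) ∨ (u ∈ B ∧ v ∈ A)

/-- `(S, T)` spans a copy of the complete bipartite graph `K_{s,t}` in `G`,
with `S` the side of size `s` and `T` the side of size `t`. -/
def IsKst (G : SimpleGraph V) (s t : ℕ) (S T : Finset V) : Prop :=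
  Disjoint S T ∧ S.card = s ∧ T.card = t ∧ ∀ u ∈ S, ∀ v ∈ T, G.Adj u v

/-- `𝒯` is a perfect `K_{s,t}`-tiling of `G`: a collection of pairwise
vertex-disjoint copies of `K_{s,t}` covering all vertices. -/
def IsKstTiling (G : SimpleGraph V) (s t : ℕ)
    (𝒯 : Finset (Finset V × Finset V)) : Prop :=
  (∀ P ∈ 𝒯, IsKst G s t P.1 P.2) ∧
  (𝒯 : Set (Finset V × Finset V)).PairwiseDisjoint (fun P => P.1 ∪ P.2) ∧
  𝒯.sup (fun P => P.1 ∪ P.2) = Finset.univ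

/-- `G` can be tiled with `K_{s,t}`. -/
def KstTileable (G : SimpleGraph V) (s t : ℕ) : Prop :=
  ∃ 𝒯 : Finset (Finset V × Finset V), IsKstTiling G s t 𝒯

/-- `G` can be tiled with the complete graph `K_s`. -/
def CliqueTileable (G : SimpleGraph V) (s : ℕ) : Prop :=
  ∃ 𝒞 : Finset (Finset V),
    (∀ S ∈ 𝒞, S.card = s ∧ G.IsClique (S : Set V)) ∧
    (𝒞 : Set (Finset V)).PairwiseDisjoint id ∧
    𝒞.sup id = Finset.univ

/-- The minimum degree of `G` equals the real number `c`. -/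
def MinDegreeIs (G : SimpleGraph V) (c : ℝ) : Prop :=
  (∀ v : V, c ≤ (degS G v Finset.univ : ℝ)) ∧
  ∃ v : V, (degS G v Finset.univ : ℝ) = c

/-- `(c, L)` is an `h`-star with centre `c ∈ A` and `h` leaves `L ⊆ B`. -/
def IsStar (G : SimpleGraph V) (h : ℕ) (A B : Finset V) (c : V) (L : Finset V) : Prop :=
  c ∈ A ∧ L ⊆ B ∧ L.card = h ∧ ∀ v ∈ L, G.Adj c v

/-- `𝒮` is a family of pairwise vertex-disjoint `h`-stars from `A` to `B`. -/
def StarFamily (G : SimpleGraph V) (h : ℕ) (A B : Finset V)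
    (𝒮 : Finset (V × Finset V)) : Prop :=
  (∀ S ∈ 𝒮, IsStar G h A B S.1 S.2) ∧
  (𝒮 : Set (V × Finset V)).PairwiseDisjoint (fun S => insert S.1 S.2)

/-- The structure hypotheses (H) for the extremal construction of the paper:
`1 ≤ s < t`, `t ≥ 2s+1`, `k ≥ 1`, `G` is bipartite with parts
`U₀ ∪ U₁ ∪ U₂` and `V₀ ∪ V₁ ∪ V₂`, with the prescribed part sizes,
complete pairs `(U₁,V₁)`, `(U₂,V₂)`, `(U₀, V₁∪V₂)`, `(V₀, U₁∪U₂)`,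
no edges between `U₀` and `V₀`, and sparse `K_{2,2}`-free diagonal pairs. -/
structure StructH (G : SimpleGraph V) (s t k : ℕ)
    (U0 U1 U2 V0 V1 V2 : Finset V) : Prop where
  hs : 1 ≤ s
  hst : s < t
  ht : 2 * s + 1 ≤ t
  hk : 1 ≤ k
  bip : IsBipartition G (U0 ∪ U1 ∪ U2) (V0 ∪ V1 ∪ V2)
  hU01 : Disjoint U0 U1
  hU02 : Disjoint U0 U2
  hU12 : Disjoint U1 U2
  hV01 : Disjoint V0 V1
  hV02 : Disjoint V0 V2
  hV12 : Disjoint V1 V2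
  cardU0 : U0.card = s - 1
  cardV0 : V0.card = s - 1
  cardU1 : U1.card = k * (s + t) + (t + 1) / 2
  cardV2 : V2.card = k * (s + t) + (t + 1) / 2
  cardV1 : V1.card = k * (s + t) + (t + 2) / 2
  cardU2 : U2.card = k * (s + t) + (t + 2) / 2
  compU1V1 : ∀ u ∈ U1, ∀ v ∈ V1, G.Adj u v
  compU2V2 : ∀ u ∈ U2, ∀ v ∈ V2, G.Adj u v
  compU0 : ∀ u ∈ U0, ∀ v ∈ V1 ∪ V2, G.Adj u v
  compV0 : ∀ v ∈ V0, ∀ u ∈ U1 ∪ U2, G.Adj u v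
  emptyU0V0 : ∀ u ∈ U0, ∀ v ∈ V0, ¬ G.Adj u v
  K22freeU1V2 : ∀ S T : Finset V, S ⊆ U1 → T ⊆ V2 → ¬ IsKst G 2 2 S T
  K22freeU2V1 : ∀ S T : Finset V, S ⊆ U2 → T ⊆ V1 → ¬ IsKst G 2 2 S T
  degU1 : ∀ u ∈ U1, degS G u V2 ≤ s - 1
  degU2 : ∀ u ∈ U2, degS G u V1 ≤ s - 1
  degV1 : ∀ v ∈ V1, degS G v U2 ≤ s - 1
  degV2 : ∀ v ∈ V2, degS G v U1 ≤ s - 1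

/-- The vertex set `W` of a copy of `K_{s,t}` is crossing. -/
def Crossing (U1 V1 U2 V2 W : Finset V) : Prop :=
  (W ∩ (U1 ∪ V1)).Nonempty ∧ (W ∩ (U2 ∪ V2)).Nonempty

/-- `W` is crossing from the set `A`, where `AD = A^D` is the diagonal set of `A`
and `AM = A^M` is the opposite middle set of `A`. -/
def CrossingFrom (W A AD AM : Finset V) : Prop :=
  (W ∩ A).card = 1 ∧
    (2 ≤ (W ∩ AD).card ∨ ((W ∩ AD).card = 1 ∧ (W ∩ AM).Nonempty))

/-- `W` is of Type 1 (crossing from `A`), where `AD = A^D`, `AN = A^N`,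
`ANM = (A^N)^M`. -/
def Type1From (s t : ℕ) (W AD AN ANM : Finset V) : Prop :=
  ∃ p : ℕ, 2 ≤ p ∧ p ≤ s - 1 ∧ (W ∩ ANM).card = s - 1 ∧
    (W ∩ AN).card = t - p ∧ (W ∩ AD).card = p

/-- `W` is of Type 2 (crossing from `A`), where `AD = A^D`, `AM = A^M`,
`AND = (A^N)^D`. -/
def Type2From (s t : ℕ) (W AD AM AND : Finset V) : Prop :=
  ∃ p : ℕ, 1 ≤ p ∧ p ≤ s - 1 ∧ (W ∩ AND).card = t - 1 ∧
    (W ∩ AM).card = s - p ∧ (W ∩ AD).card = p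

/-- A vertex of `A ∩ W` that is joined to all of `W ∩ B` bounds `|W ∩ B|` by its degree in `B`. -/
theorem card_inter_le_of_degS_le {V : Type*} [DecidableEq V]
    {G : SimpleGraph V} {A B W : Finset V} {d : ℕ}
    (hadj : ∀ u ∈ W ∩ A, ∀ v ∈ W ∩ B, G.Adj u v)
    (hdeg : ∀ u ∈ A, degS G u B ≤ d) (hA : 1 ≤ (W ∩ A).card) :
    (W ∩ B).card ≤ d := by
  obtain ⟨u, hu⟩ := Finset.card_pos.mp hA
  refine le_trans (Finset.card_le_card fun v hv => ?_) (hdeg u (Finset.mem_inter.mp hu).2)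
  exact Finset.mem_filter.mpr ⟨(Finset.mem_inter.mp hv).2, hadj u hu v hv⟩

/-- A complete pair inside a `K_{2,2}`-free pair has a side with at most one vertex. -/
theorem card_inter_le_one_of_K22free {V : Type*} [DecidableEq V]
    {G : SimpleGraph V} {A B W : Finset V}
    (hadj : ∀ u ∈ W ∩ A, ∀ v ∈ W ∩ B, G.Adj u v)
    (hfree : ∀ S T : Finset V, S ⊆ A → T ⊆ B → ¬ IsKst G 2 2 S T) :
    (W ∩ A).card ≤ 1 ∨ (W ∩ B).card ≤ 1 := by
  by_contra! h
  obtain ⟨S, hS, hSc⟩ := Finset.exists_subset_card_eq (Nat.succ_le_of_lt h.1)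
  obtain ⟨T, hT, hTc⟩ := Finset.exists_subset_card_eq (Nat.succ_le_of_lt h.2)
  refine hfree S T (hS.trans Finset.inter_subset_right) (hT.trans Finset.inter_subset_right)
    ⟨?_, hSc, hTc, fun u hu v hv => hadj u (hS hu) v (hT hv)⟩
  exact Finset.disjoint_left.mpr fun x hx hx' => G.loopless.irrefl x (hadj x (hS hx) x (hT hx'))

theorem card_inter_union_union {V : Type*} [DecidableEq V] {W A B C : Finset V}
    (hAB : Disjoint A B) (hAC : Disjoint A C) (hBC : Disjoint B C) :
    (W ∩ (A ∪ B ∪ C)).card = (W ∩ A).card + (W ∩ B).card + (W ∩ C).card := by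
  have hmono : ∀ {X Y : Finset V}, Disjoint X Y → Disjoint (W ∩ X) (W ∩ Y) := fun h =>
    h.mono Finset.inter_subset_right Finset.inter_subset_right
  rw [Finset.inter_union_distrib_left,
    Finset.card_union_of_disjoint (hmono (Finset.disjoint_union_left.mpr ⟨hAC, hBC⟩)),
    Finset.inter_union_distrib_left, Finset.card_union_of_disjoint (hmono hAB)]

/-- The intersection sizes of a crossing copy whose side of size `s` lies in the
`U`-part determine its type. -/
theorem types_of_card_inter {V : Type*} [DecidableEq V]
    {s t : ℕ} {W U0 U1 U2 V0 V1 V2 : Finset V} (hs : 1 ≤ s) (ht : 2 * s + 1 ≤ t)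
    (hU : (W ∩ U0).card + (W ∩ U1).card + (W ∩ U2).card = s)
    (hV : (W ∩ V0).card + (W ∩ V1).card + (W ∩ V2).card = t)
    (hU0 : (W ∩ U0).card ≤ s - 1) (hV0 : (W ∩ V0).card ≤ s - 1)
    (h00 : (W ∩ U0).card = 0 ∨ (W ∩ V0).card = 0)
    (h12 : (W ∩ U1).card ≤ 1 ∨ (W ∩ V2).card ≤ 1)
    (h21 : (W ∩ U2).card ≤ 1 ∨ (W ∩ V1).card ≤ 1)
    (hdU1 : 1 ≤ (W ∩ U1).card → (W ∩ V2).card ≤ s - 1)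
    (hdU2 : 1 ≤ (W ∩ U2).card → (W ∩ V1).card ≤ s - 1)
    (hdV1 : 1 ≤ (W ∩ V1).card → (W ∩ U2).card ≤ s - 1)
    (hdV2 : 1 ≤ (W ∩ V2).card → (W ∩ U1).card ≤ s - 1)
    (hc1 : 1 ≤ (W ∩ U1).card ∨ 1 ≤ (W ∩ V1).card)
    (hc2 : 1 ≤ (W ∩ U2).card ∨ 1 ≤ (W ∩ V2).card) :
    (CrossingFrom W U1 V2 V0 ∧
      (Type1From s t W V2 V1 U0 ∨ Type2From s t W V2 V0 U2)) ∨
    (CrossingFrom W U2 V1 V0 ∧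
      (Type1From s t W V1 V2 U0 ∨ Type2From s t W V1 V0 U1)) ∨
    (CrossingFrom W V1 U2 U0 ∧
      (Type1From s t W U2 U1 V0 ∨ Type2From s t W U2 U0 V2)) ∨
    (CrossingFrom W V2 U1 U0 ∧
      (Type1From s t W U1 U2 V0 ∨ Type2From s t W U1 U0 V1)) := by
  simp only [CrossingFrom, ← Finset.card_pos]
  have hcases :
      ((W ∩ U1).card = 1 ∧ (W ∩ U0).card = s - 1 ∧ 2 ≤ (W ∩ V2).card ∧
        (W ∩ V2).card ≤ s - 1 ∧ (W ∩ V1).card = t - (W ∩ V2).card) ∨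
      ((W ∩ U2).card = 1 ∧ (W ∩ U0).card = s - 1 ∧ 2 ≤ (W ∩ V1).card ∧
        (W ∩ V1).card ≤ s - 1 ∧ (W ∩ V2).card = t - (W ∩ V1).card) ∨
      ((W ∩ V1).card = 1 ∧ (W ∩ V2).card = t - 1 ∧ 1 ≤ (W ∩ U2).card ∧
        (W ∩ U2).card ≤ s - 1 ∧ (W ∩ U0).card = s - (W ∩ U2).card) ∨
      ((W ∩ V2).card = 1 ∧ (W ∩ V1).card = t - 1 ∧ 1 ≤ (W ∩ U1).card ∧
        (W ∩ U1).card ≤ s - 1 ∧ (W ∩ U0).card = s - (W ∩ U1).card) := by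
    have hV0' : (W ∩ V0).card = 0 := by
      refine h00.resolve_left fun hU0' => ?_
      rcases Nat.eq_zero_or_pos (W ∩ U1).card with h1 | h1
      · rcases Nat.eq_zero_or_pos (W ∩ V1).card with h1' | h1' <;> omega
      · rcases Nat.eq_zero_or_pos (W ∩ U2).card with h2 | h2
        · rcases Nat.eq_zero_or_pos (W ∩ V2).card with h2' | h2' <;> omega
        · have := hdU1 h1
          have := hdU2 h2
          omega
    clear h00
    rcases le_or_gt (W ∩ V1).card s with hlt | hlt
    · have hU1' : (W ∩ U1).card = 0 := by
        by_contra h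
        have := hdU1 (by omega)
        omega
      have hU2' : 1 ≤ (W ∩ U2).card := by omega
      have hV1' : 1 ≤ (W ∩ V1).card := by omega
      have := hdU2 hU2'
      have := hdV1 hV1'
      rcases Nat.eq_or_lt_of_le hV1' with h | h
      · refine Or.inr (Or.inr (Or.inl ?_))
        omega
      · refine Or.inr (Or.inl ?_)
        omega
    · have hU2' : (W ∩ U2).card = 0 := by
        by_contra h
        have := hdU2 (by omega)
        omega
      have hU1' : 1 ≤ (W ∩ U1).card := by omega
      have hV2' : 1 ≤ (W ∩ V2).card := by omega
      have := hdU1 hU1'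
      have := hdV2 hV2'
      rcases Nat.eq_or_lt_of_le hV2' with h | h
      · refine Or.inr (Or.inr (Or.inr ?_))
        omega
      · refine Or.inl ?_
        omega
  rcases hcases with ⟨h, h0, h2, hle, hN⟩ | ⟨h, h0, h2, hle, hN⟩ |
      ⟨h, hN, h1, hle, h0⟩ | ⟨h, hN, h1, hle, h0⟩
  · exact Or.inl ⟨⟨h, Or.inl h2⟩, Or.inl ⟨_, h2, hle, h0, hN, rfl⟩⟩
  · exact Or.inr (Or.inl ⟨⟨h, Or.inl h2⟩, Or.inl ⟨_, h2, hle, h0, hN, rfl⟩⟩)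
  · exact Or.inr (Or.inr (Or.inl ⟨⟨h, by omega⟩, Or.inr ⟨_, h1, hle, hN, h0, rfl⟩⟩))
  · exact Or.inr (Or.inr (Or.inr ⟨⟨h, by omega⟩, Or.inr ⟨_, h1, hle, hN, h0, rfl⟩⟩))

/-- The two sides of a copy of `K_{s,t}` lie in different parts of a bipartition. -/
theorem IsKst.subset_parts {V : Type*} [Fintype V] [DecidableEq V]
    {G : SimpleGraph V} {s t : ℕ} {A B S T : Finset V} (hs : 1 ≤ s) (ht : 1 ≤ t)
    (hbip : IsBipartition G A B) (hK : IsKst G s t S T) :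
    (S ⊆ A ∧ T ⊆ B) ∨ (S ⊆ B ∧ T ⊆ A) := by
  obtain ⟨hAB, -, hedge⟩ := hbip
  obtain ⟨-, hS, hT, hadj⟩ := hK
  obtain ⟨a, ha⟩ := Finset.card_pos.mp (hS ▸ hs : 0 < S.card)
  obtain ⟨b, hb⟩ := Finset.card_pos.mp (hT ▸ ht : 0 < T.card)
  have hdisj : ∀ x ∈ A, x ∉ B := fun x hx => Finset.disjoint_left.mp hAB hx
  rcases hedge a b (hadj a ha b hb) with ⟨haA, hbB⟩ | ⟨haB, hbA⟩
  · refine Or.inl ⟨fun x hx => ?_, fun y hy => ?_⟩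
    · exact (hedge x b (hadj x hx b hb)).elim And.left fun h => absurd hbB (hdisj b h.2)
    · exact (hedge a y (hadj a ha y hy)).elim And.right fun h => absurd h.1 (hdisj a haA)
  · refine Or.inr ⟨fun x hx => ?_, fun y hy => ?_⟩
    · exact (hedge x b (hadj x hx b hb)).elim (fun h => absurd h.2 (hdisj b hbA)) And.left
    · exact (hedge a y (hadj a ha y hy)).elim (fun h => absurd haB (hdisj a h.1)) And.right

theorem union_inter_eq_of_subset {V : Type*} [DecidableEq V] {A B S T : Finset V}
    (hAB : Disjoint A B) (hS : S ⊆ A) (hT : T ⊆ B) :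
    (S ∪ T) ∩ A = S ∧ (S ∪ T) ∩ B = T := by
  constructor
  · rw [Finset.union_inter_distrib_right, Finset.inter_eq_left.mpr hS,
      Finset.disjoint_iff_inter_eq_empty.mp (hAB.symm.mono_left hT), Finset.union_empty]
  · rw [Finset.union_inter_distrib_right, Finset.inter_eq_left.mpr hT,
      Finset.disjoint_iff_inter_eq_empty.mp (hAB.mono_left hS), Finset.empty_union]

/-- Claim 3.3: under the structure hypotheses (H), every
crossing copy of `K_{s,t}` is crossing from some `A ∈ 𝒲` and is of Type 1
or of Type 2 from that `A`. -/
theorem claim_types {V : Type*} [Fintype V] [DecidableEq V]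
    (G : SimpleGraph V) (s t k : ℕ) (U0 U1 U2 V0 V1 V2 : Finset V)
    (hH : StructH G s t k U0 U1 U2 V0 V1 V2)
    (S T : Finset V) (hK : IsKst G s t S T)
    (W : Finset V) (hW : W = S ∪ T)
    (hcross : Crossing U1 V1 U2 V2 W) :
    (CrossingFrom W U1 V2 V0 ∧
      (Type1From s t W V2 V1 U0 ∨ Type2From s t W V2 V0 U2)) ∨
    (CrossingFrom W U2 V1 V0 ∧
      (Type1From s t W V1 V2 U0 ∨ Type2From s t W V1 V0 U1)) ∨
    (CrossingFrom W V1 U2 U0 ∧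
      (Type1From s t W U2 U1 V0 ∨ Type2From s t W U2 U0 V2)) ∨
    (CrossingFrom W V2 U1 U0 ∧
      (Type1From s t W U1 U2 V0 ∨ Type2From s t W U1 U0 V1)) := by
  have hs := hH.hs
  have ht := hH.ht
  have hsides : ((W ∩ (U0 ∪ U1 ∪ U2)).card = s ∧ (W ∩ (V0 ∪ V1 ∪ V2)).card = t ∨
      (W ∩ (V0 ∪ V1 ∪ V2)).card = s ∧ (W ∩ (U0 ∪ U1 ∪ U2)).card = t) ∧
      ∀ u ∈ W ∩ (U0 ∪ U1 ∪ U2), ∀ v ∈ W ∩ (V0 ∪ V1 ∪ V2), G.Adj u v := by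
    subst hW
    obtain ⟨-, hSc, hTc, hadj⟩ := id hK
    rcases hK.subset_parts hs (by omega) hH.bip with ⟨hS, hT⟩ | ⟨hS, hT⟩
    · obtain ⟨hSe, hTe⟩ := union_inter_eq_of_subset hH.bip.1 hS hT
      rw [hSe, hTe]
      exact ⟨Or.inl ⟨hSc, hTc⟩, hadj⟩
    · obtain ⟨hSe, hTe⟩ := union_inter_eq_of_subset hH.bip.1.symm hS hT
      rw [hSe, hTe]
      exact ⟨Or.inr ⟨hSc, hTc⟩, fun u hu v hv => (hadj v hv u hu).symm⟩
  obtain ⟨hcard, hadj⟩ := hsides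
  rw [card_inter_union_union hH.hU01 hH.hU02 hH.hU12,
    card_inter_union_union hH.hV01 hH.hV02 hH.hV12] at hcard
  have hsub : ∀ {A B : Finset V}, A ⊆ U0 ∪ U1 ∪ U2 → B ⊆ V0 ∪ V1 ∪ V2 →
      ∀ u ∈ W ∩ A, ∀ v ∈ W ∩ B, G.Adj u v := fun hA hB u hu v hv =>
    hadj u (Finset.inter_subset_inter_left hA hu) v (Finset.inter_subset_inter_left hB hv)
  have hU0sub : U0 ⊆ U0 ∪ U1 ∪ U2 := by grind
  have hU1sub : U1 ⊆ U0 ∪ U1 ∪ U2 := by grind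
  have hU2sub : U2 ⊆ U0 ∪ U1 ∪ U2 := by grind
  have hV0sub : V0 ⊆ V0 ∪ V1 ∪ V2 := by grind
  have hV1sub : V1 ⊆ V0 ∪ V1 ∪ V2 := by grind
  have hV2sub : V2 ⊆ V0 ∪ V1 ∪ V2 := by grind
  have hadj12 := hsub hU1sub hV2sub
  have hadj21 := hsub hU2sub hV1sub
  have hU0 : (W ∩ U0).card ≤ s - 1 := hH.cardU0 ▸ Finset.card_le_card Finset.inter_subset_right
  have hV0 : (W ∩ V0).card ≤ s - 1 := hH.cardV0 ▸ Finset.card_le_card Finset.inter_subset_right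
  have h00 : (W ∩ U0).card = 0 ∨ (W ∩ V0).card = 0 := by
    by_contra! h
    obtain ⟨u, hu⟩ := Finset.card_ne_zero.mp h.1
    obtain ⟨v, hv⟩ := Finset.card_ne_zero.mp h.2
    exact hH.emptyU0V0 u (Finset.mem_inter.mp hu).2 v (Finset.mem_inter.mp hv).2
      (hsub hU0sub hV0sub u hu v hv)
  have h12 := card_inter_le_one_of_K22free hadj12 hH.K22freeU1V2
  have h21 := card_inter_le_one_of_K22free hadj21 hH.K22freeU2V1
  have hdU1 := card_inter_le_of_degS_le hadj12 hH.degU1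
  have hdU2 := card_inter_le_of_degS_le hadj21 hH.degU2
  have hdV1 := card_inter_le_of_degS_le (fun v hv u hu => (hadj21 u hu v hv).symm) hH.degV1
  have hdV2 := card_inter_le_of_degS_le (fun v hv u hu => (hadj12 u hu v hv).symm) hH.degV2
  obtain ⟨hc1, hc2⟩ := hcross
  rw [Finset.inter_union_distrib_left, Finset.union_nonempty, ← Finset.card_pos,
    ← Finset.card_pos] at hc1 hc2
  rcases hcard with ⟨hU, hV⟩ | ⟨hV, hU⟩
  · exact types_of_card_inter hs ht hU hV hU0 hV0 h00 h12 h21 hdU1 hdU2 hdV1 hdV2 hc1 hc2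
  · have h := types_of_card_inter hs ht hV hU hV0 hU0 h00.symm h21.symm h12.symm
      hdV1 hdV2 hdU1 hdU2 hc1.symm hc2.symm
    rcases h with h | h | h | h
    · exact Or.inr (Or.inr (Or.inl h))
    · exact Or.inr (Or.inr (Or.inr h))
    · exact Or.inl h
    · exact Or.inr (Or.inl h)

end PaperTiling
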